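/- Let C be the extended ternary quadratic residue code of length 14. The shell C_10 is a combinatorial 3-(14, 10, 180) design with repeated blocks: for every 3-element subset T of {1,…,14}, the number of codewords c ∈ C with wt(c) = 10 and T ⊆ supp(c) equals 180. -/

import Mathlib

open scoped Classical

noncomputable section

/-- Membership in the ternary quadratic residue code of length 13: the codeword, viewed
as the polynomial `∑ cᵢ Xⁱ` modulo `X ^ 13 - 1`, lies in the ideal generated by the
polynomial whose roots are `α ^ ℓ` for `ℓ` running over the nonzero squares mod 13;
equivalently (as that generator is separable and divides `X ^ 13 - 1`), the codeword
polynomial vanishes at `α ^ ℓ` for every nonzero square `ℓ` modulo 13. -/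
def qr3Mem {K : Type} [Field K] [Algebra (ZMod 3) K] (α : K) (c : Fin 13 → ZMod 3) : Prop :=
  ∀ ℓ : ZMod 13, ℓ ≠ 0 → IsSquare ℓ →
    ∑ i : Fin 13, algebraMap (ZMod 3) K (c i) * α ^ (ℓ.val * (i : ℕ)) = 0

/-- Membership in the extended ternary quadratic residue code of length 14: the first 13
coordinates form a codeword of the quadratic residue code of length 13 and the last
coordinate is minus the sum of the first 13. -/
def extQR3Mem {K : Type} [Field K] [Algebra (ZMod 3) K] (α : K) (c : Fin 14 → ZMod 3) : Prop :=
  qr3Mem α (fun i => c i.castSucc) ∧ c (Fin.last 13) = - ∑ i : Fin 13, c i.castSucc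

/-- Hamming weight: the number of nonzero coordinates. -/
def wt {n : ℕ} {F : Type} [Zero F] (c : Fin n → F) : ℕ :=
  (Finset.univ.filter fun i => c i ≠ 0).card

/-- Support: the set of nonzero coordinate positions. -/
def supp {n : ℕ} {F : Type} [Zero F] (c : Fin n → F) : Finset (Fin n) :=
  Finset.univ.filter fun i => c i ≠ 0

/-! ### Counting in a ternary span by packed arithmetic -/

/-- All the numbers `v + ∑ aₖ gₖ` with `gₖ` running over the list and `aₖ ∈ {0, 1, 2}`. -/
def packedSpan : List ℕ → ℕ → List ℕ
  | [], v => [v]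
  | g :: gs, v => packedSpan gs v ++ (packedSpan gs (v + g) ++ packedSpan gs (v + 2 * g))

/-- Whether the `j`-th digit of `v` in base 32 is nonzero modulo 3. -/
def trit (v j : ℕ) : Bool :=
  Nat.blt 0 (Nat.mod (Nat.mod (Nat.div v (Nat.pow 32 j)) 32) 3)

/-- The number of the first 14 base 32 digits of `v` that are nonzero modulo 3. -/
def packedWt (v : ℕ) : ℕ := (List.range 14).countP (trit v)

/-- The elements of the packed span that represent vectors of weight 10. -/
def shellTen (rows : List ℕ) : List ℕ :=
  (packedSpan rows 0).filter fun v => Nat.beq (packedWt v) 10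

/-- Every triple of positions in `{0, …, 13}` is covered exactly 180 times by the list. -/
def coversTriples (L : List ℕ) : Bool :=
  (List.range 14).all fun k =>
    let Lk := L.filter (trit · k)
    (List.range k).all fun j =>
      let Lj := Lk.filter (trit · j)
      (List.range j).all fun i => Nat.beq (Lj.countP (trit · i)) 180

/-- The rows of a matrix of natural numbers, each written as the base 32 digits of a number. -/
def packRows {k n : ℕ} (G : Fin k → Fin n → ℕ) : List ℕ :=
  List.ofFn fun r => ∑ j, G r j * 32 ^ (j : ℕ)

/-- The linear combination of the rows of `G` modulo 3 with coefficients `m`. -/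
def encode {k n : ℕ} (G : Fin k → Fin n → ℕ) (m : Fin k → ZMod 3) (j : Fin n) : ZMod 3 :=
  ∑ r, m r * (G r j : ZMod 3)

lemma sum_packedSpan (F : ℕ → ℕ) {n : ℕ} (g : Fin n → ℕ) (v : ℕ) :
    ((packedSpan (List.ofFn g) v).map F).sum =
      ∑ m : Fin n → ZMod 3, F (v + ∑ k, (m k).val * g k) := by
  induction n generalizing v with
  | zero => simp [packedSpan]
  | succ n ih =>
    rw [← (Fin.consEquiv fun _ => ZMod 3).sum_comp, Fintype.sum_prod_type]
    have hsum (f : ZMod 3 → ℕ) : ∑ a, f a = f 0 + (f 1 + f 2) := by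
      rw [← add_assoc]; exact Fin.sum_univ_three f
    have h1 : (1 : ZMod 3).val = 1 := rfl
    have h2 : (2 : ZMod 3).val = 2 := rfl
    rw [hsum]
    simp [packedSpan, List.ofFn_succ, ih, Fin.sum_univ_succ, h1, h2, add_assoc]

lemma countP_packedSpan (p : ℕ → Bool) {k n : ℕ} (G : Fin k → Fin n → ℕ) :
    (packedSpan (packRows G) 0).countP p = (Finset.univ.filter fun m : Fin k → ZMod 3 =>
      p (∑ r, (m r).val * ∑ i, G r i * 32 ^ (i : ℕ)) = true).card := by
  have hp (L : List ℕ) : L.countP p = (L.map fun v => if p v = true then 1 else 0).sum := by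
    induction L with
    | nil => rfl
    | cons v L ih => rw [List.countP_cons, ih, List.map_cons, List.sum_cons, add_comm]
  rw [hp, packRows, sum_packedSpan, Finset.card_filter]
  simp only [zero_add]

lemma digit_sum_mul_pow {b n : ℕ} (a : Fin n → ℕ) (ha : ∀ j, a j < b) (j : Fin n) :
    (∑ i, a i * b ^ (i : ℕ)) / b ^ (j : ℕ) % b = a j := by
  induction n with
  | zero => exact j.elim0
  | succ n ih =>
    have hb : 0 < b := (Nat.zero_le _).trans_lt (ha 0)
    have hs : ∑ i, a i * b ^ (i : ℕ) = a 0 + b * ∑ i : Fin n, a i.succ * b ^ (i : ℕ) := by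
      rw [Fin.sum_univ_succ, Finset.mul_sum]
      simp [pow_succ, mul_comm, mul_left_comm]
    rw [hs]
    refine Fin.cases ?_ (fun j => ?_) j
    · simp [Nat.mod_eq_of_lt (ha 0)]
    · rw [Fin.val_succ, pow_succ', ← Nat.div_div_eq_div_mul, Nat.add_mul_div_left _ _ hb,
        Nat.div_eq_of_lt (ha 0), zero_add]
      exact ih (fun i => a i.succ) (fun i => ha i.succ) j

lemma trit_packed {k n : ℕ} (hk : 4 * k < 32) (G : Fin k → Fin n → ℕ) (hG : ∀ r j, G r j ≤ 2)
    (m : Fin k → ZMod 3) (j : Fin n) :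
    trit (∑ r, (m r).val * ∑ i, G r i * 32 ^ (i : ℕ)) j = true ↔ encode G m j ≠ 0 := by
  have hswap : ∑ r, (m r).val * ∑ i, G r i * 32 ^ (i : ℕ) =
      ∑ i, (∑ r, (m r).val * G r i) * 32 ^ (i : ℕ) := by
    simp_rw [Finset.mul_sum, Finset.sum_mul, mul_assoc]
    exact Finset.sum_comm
  have hlt (i : Fin n) : ∑ r, (m r).val * G r i < 32 := by
    refine lt_of_le_of_lt (Finset.sum_le_card_nsmul _ _ 4 fun r _ => ?_)
      (by simpa [mul_comm 4] using hk)
    exact Nat.mul_le_mul (Nat.le_of_lt_succ (ZMod.val_lt (m r))) (hG r i)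
  have hcast : encode G m j = ((∑ r, (m r).val * G r j : ℕ) : ZMod 3) := by
    simp [encode]
  have hdigit := digit_sum_mul_pow _ hlt j
  rw [hcast, Ne, ZMod.natCast_eq_zero_iff, Nat.dvd_iff_mod_eq_zero, hswap]
  change Nat.blt 0 ((∑ i, (∑ r, (m r).val * G r i) * 32 ^ (i : ℕ)) / 32 ^ (j : ℕ) % 32 % 3) = true
    ↔ _
  rw [hdigit, Nat.blt_eq, Nat.pos_iff_ne_zero]

lemma packedWt_packed {k : ℕ} (hk : 4 * k < 32) (G : Fin k → Fin 14 → ℕ)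
    (hG : ∀ r j, G r j ≤ 2) (m : Fin k → ZMod 3) :
    packedWt (∑ r, (m r).val * ∑ i, G r i * 32 ^ (i : ℕ)) = wt (encode G m) := by
  have h (p : ℕ → Bool) : (List.range 14).countP p = ∑ j : Fin 14, if p j = true then 1 else 0 := by
    rw [Fin.sum_univ_eq_sum_range fun j => if p j = true then 1 else 0]
    simp [List.range_succ, Finset.sum_range_succ, List.countP_cons, -Finset.sum_boole]
    ac_rfl
  rw [packedWt, h, wt, Finset.card_filter]
  refine Finset.sum_congr rfl fun j _ => ?_
  by_cases hj : encode G m j ≠ 0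
  · rw [if_pos hj, if_pos ((trit_packed hk G hG m j).mpr hj)]
  · rw [if_neg hj, if_neg (mt (trit_packed hk G hG m j).mp hj)]

lemma exists_lt_lt_of_card_eq_three {n : ℕ} {T : Finset (Fin n)} (hT : T.card = 3) :
    ∃ i j k : Fin n, i < j ∧ j < k ∧ T = {i, j, k} := by
  refine ⟨T.orderEmbOfFin hT 0, T.orderEmbOfFin hT 1, T.orderEmbOfFin hT 2, by simp, by simp, ?_⟩
  rw [← Finset.coe_inj, ← Finset.range_orderEmbOfFin T hT]
  ext x
  simp only [Finset.coe_insert, Finset.coe_singleton, Set.mem_insert_iff, Set.mem_singleton_iff,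
    Set.mem_range, Fin.exists_fin_succ]
  simp [eq_comm]

lemma card_encode_of_coversTriples {k : ℕ} (hk : 4 * k < 32) (G : Fin k → Fin 14 → ℕ)
    (hG : ∀ r j, G r j ≤ 2) (hcov : coversTriples (shellTen (packRows G)) = true)
    {T : Finset (Fin 14)} (hT : T.card = 3) :
    (Finset.univ.filter fun m : Fin k → ZMod 3 =>
      wt (encode G m) = 10 ∧ T ⊆ supp (encode G m)).card = 180 := by
  obtain ⟨a, b, c, hab, hbc, rfl⟩ := exists_lt_lt_of_card_eq_three hT
  simp only [coversTriples, List.all_eq_true, List.mem_range, Nat.beq_eq] at hcov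
  have h := hcov c c.isLt b hbc a hab
  rw [List.countP_filter, List.countP_filter, shellTen, List.countP_filter,
    countP_packedSpan] at h
  rw [← h]
  refine congrArg Finset.card (Finset.filter_congr fun m _ => ?_)
  simp only [Bool.and_eq_true, Nat.beq_eq, packedWt_packed hk G hG, trit_packed hk G hG,
    Finset.insert_subset_iff, Finset.singleton_subset_iff, supp, Finset.mem_filter,
    Finset.mem_univ, true_and]
  tauto

/-! ### Generator matrices of the two extended quadratic residue codes -/

/-- Generator matrix of the code for which the sum of the roots is `0`. -/
def genZero : Fin 7 → Fin 14 → ℕ :=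
  ![![1, 0, 2, 2, 2, 0, 1, 0, 0, 0, 0, 0, 0, 1],
    ![0, 1, 0, 2, 2, 2, 0, 1, 0, 0, 0, 0, 0, 1],
    ![1, 0, 0, 2, 1, 2, 0, 0, 1, 0, 0, 0, 0, 2],
    ![1, 1, 2, 2, 1, 1, 0, 0, 0, 1, 0, 0, 0, 0],
    ![2, 1, 2, 0, 0, 1, 0, 0, 0, 0, 1, 0, 0, 2],
    ![2, 2, 2, 0, 1, 0, 0, 0, 0, 0, 0, 1, 0, 1],
    ![0, 2, 2, 2, 0, 1, 0, 0, 0, 0, 0, 0, 1, 1]]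

/-- Generator matrix of the code for which the sum of the roots is `-1`. -/
def genNegOne : Fin 7 → Fin 14 → ℕ :=
  ![![1, 1, 2, 0, 2, 1, 1, 0, 0, 0, 0, 0, 0, 1],
    ![2, 0, 2, 2, 1, 1, 0, 1, 0, 0, 0, 0, 0, 0],
    ![2, 1, 1, 2, 0, 0, 0, 0, 1, 0, 0, 0, 0, 2],
    ![0, 2, 1, 1, 2, 0, 0, 0, 0, 1, 0, 0, 0, 2],
    ![0, 0, 2, 1, 1, 2, 0, 0, 0, 0, 1, 0, 0, 2],
    ![1, 1, 2, 2, 0, 2, 0, 0, 0, 0, 0, 1, 0, 0],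
    ![1, 2, 0, 2, 1, 1, 0, 0, 0, 0, 0, 0, 1, 1]]

lemma packRows_genZero :
    packRows genZero =
      [36893488148495009793, 36893488181848113184, 73786977394418057217, 35184406759457,
       73788102194778605602, 36929516944439117890, 38046409652059572288] := by
  decide +kernel

lemma coversTriples_genZero : coversTriples (shellTen (packRows genZero)) = true := by
  rw [packRows_genZero]
  decide +kernel

lemma packRows_genNegOne :
    packRows genNegOne =
      [36893488148528498721, 34394408962, 73786977394349900834, 73787011479212426304,
       73788102194813241344, 36028797086140449, 38046409652060618817] := by
  decide +kernel

lemma coversTriples_genNegOne : coversTriples (shellTen (packRows genNegOne)) = true := by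
  rw [packRows_genNegOne]
  decide +kernel

/-- A generator matrix of an extended code whose columns `6, …, 12` form the identity matrix. -/
structure IsSystematic (G : Fin 7 → Fin 14 → ℕ) : Prop where
  le_two : ∀ r j, G r j ≤ 2
  identity : ∀ r s : Fin 7, G r (Fin.castSucc (Fin.natAdd 6 s)) = if r = s then 1 else 0
  last : ∀ r, (G r (Fin.last 13) : ZMod 3) = -∑ i : Fin 13, (G r i.castSucc : ZMod 3)

lemma isSystematic_genZero : IsSystematic genZero :=
  ⟨by decide, by decide, by decide⟩

lemma isSystematic_genNegOne : IsSystematic genNegOne :=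
  ⟨by decide, by decide, by decide⟩

lemma IsSystematic.encode_apply {G : Fin 7 → Fin 14 → ℕ} (hG : IsSystematic G)
    (m : Fin 7 → ZMod 3) (s : Fin 7) :
    encode G m (Fin.castSucc (Fin.natAdd 6 s)) = m s := by
  simp only [encode, hG.identity]
  simp

lemma IsSystematic.encode_injective {G : Fin 7 → Fin 14 → ℕ} (hG : IsSystematic G) :
    Function.Injective (encode G) := fun m m' h => by
  ext1 s
  rw [← hG.encode_apply m s, h, hG.encode_apply]

section Code

variable {K : Type} [Field K]

lemma root_genZero {x : K} (h3 : (3 : K) = 0) (hx : IsPrimitiveRoot x 13)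
    (hs : x + x ^ 3 + x ^ 4 + x ^ 9 + x ^ 10 + x ^ 12 = 0) :
    x ^ 6 - x ^ 4 - x ^ 3 - x ^ 2 + 1 = 0 := by
  have hphi := hx.geom_sum_eq_zero (by norm_num)
  simp only [Finset.sum_range_succ, Finset.sum_range_zero] at hphi
  linear_combination (1 - x + x ^ 2 + x ^ 3 + x ^ 4 - x ^ 5) * hphi + (x + x ^ 3 + x ^ 5) * hs +
    (-x ^ 2 - x ^ 3 - 2 * x ^ 4 - x ^ 5 - x ^ 6 - x ^ 7 - x ^ 8 - x ^ 9 - x ^ 10 - x ^ 11 - x ^ 12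
    - x ^ 13 - x ^ 14 - x ^ 15) * h3

lemma row_genZero {x : K} (h3 : (3 : K) = 0)
    (hg : x ^ 6 - x ^ 4 - x ^ 3 - x ^ 2 + 1 = 0) (r : Fin 7) :
    ∑ i : Fin 13, (genZero r i.castSucc : K) * x ^ (i : ℕ) = 0 := by
  fin_cases r <;> simp [genZero, Fin.sum_univ_succ]
  · linear_combination hg + (x ^ 2 + x ^ 3 + x ^ 4) * h3
  · linear_combination x * hg + (x ^ 3 + x ^ 4 + x ^ 5) * h3
  · linear_combination (1 + x ^ 2) * hg + (x ^ 3 + x ^ 4 + x ^ 5) * h3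
  · linear_combination (1 + x + x ^ 3) * hg + (x ^ 2 + x ^ 3 + x ^ 4 + x ^ 5) * h3
  · linear_combination (-1 + x + x ^ 2 + x ^ 4) * hg + (1 + x ^ 5 + x ^ 6) * h3
  · linear_combination (-1 - x + x ^ 2 + x ^ 3 + x ^ 5) * hg +
      (1 + x - x ^ 3 + x ^ 6 + x ^ 7) * h3
  · linear_combination (-x - x ^ 2 + x ^ 3 + x ^ 4 + x ^ 6) * hg +
      (x + x ^ 2 - x ^ 4 + x ^ 7 + x ^ 8) * h3

lemma root_genNegOne {x : K} (h3 : (3 : K) = 0) (hx : IsPrimitiveRoot x 13)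
    (hs : 1 + x + x ^ 3 + x ^ 4 + x ^ 9 + x ^ 10 + x ^ 12 = 0) :
    x ^ 6 + x ^ 5 - x ^ 4 - x ^ 2 + x + 1 = 0 := by
  have hphi := hx.geom_sum_eq_zero (by norm_num)
  simp only [Finset.sum_range_succ, Finset.sum_range_zero] at hphi
  linear_combination (1 - x + x ^ 2 + x ^ 3 + x ^ 4 - x ^ 5) * hphi + (x + x ^ 3 + x ^ 5) * hs +
    (-x ^ 2 - x ^ 3 - 2 * x ^ 4 - x ^ 5 - x ^ 6 - x ^ 7 - x ^ 8 - x ^ 9 - x ^ 10 - x ^ 11 - x ^ 12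
    - x ^ 13 - x ^ 14 - x ^ 15) * h3

lemma row_genNegOne {x : K} (h3 : (3 : K) = 0)
    (hg : x ^ 6 + x ^ 5 - x ^ 4 - x ^ 2 + x + 1 = 0) (r : Fin 7) :
    ∑ i : Fin 13, (genNegOne r i.castSucc : K) * x ^ (i : ℕ) = 0 := by
  fin_cases r <;> simp [genNegOne, Fin.sum_univ_succ]
  · linear_combination hg + (x ^ 2 + x ^ 4) * h3
  · linear_combination (-1 + x) * hg + (1 + x ^ 3 + x ^ 5) * h3
  · linear_combination (-1 - x + x ^ 2) * hg + (1 + x + x ^ 6) * h3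
  · linear_combination (-x - x ^ 2 + x ^ 3) * hg + (x + x ^ 2 + x ^ 7) * h3
  · linear_combination (-x ^ 2 - x ^ 3 + x ^ 4) * hg + (x ^ 2 + x ^ 3 + x ^ 8) * h3
  · linear_combination (1 - x ^ 3 - x ^ 4 + x ^ 5) * hg +
      (x ^ 2 + x ^ 3 + x ^ 4 - x ^ 6 + x ^ 9) * h3
  · linear_combination (1 + x - x ^ 4 - x ^ 5 + x ^ 6) * hg +
      (x ^ 3 + x ^ 4 + x ^ 5 - x ^ 6 - x ^ 7 + x ^ 10) * h3

lemma sum_squares_eq_zero_or {x : K} (h3 : (3 : K) = 0) (hx : IsPrimitiveRoot x 13) :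
    x + x ^ 3 + x ^ 4 + x ^ 9 + x ^ 10 + x ^ 12 = 0 ∨
      1 + x + x ^ 3 + x ^ 4 + x ^ 9 + x ^ 10 + x ^ 12 = 0 := by
  have h13 := hx.pow_eq_one
  have hphi := hx.geom_sum_eq_zero (by norm_num)
  simp only [Finset.sum_range_succ, Finset.sum_range_zero] at hphi
  rw [← mul_eq_zero]
  linear_combination (6 + 2 * x + 2 * x ^ 2 + 2 * x ^ 3 + x ^ 5 + 2 * x ^ 6 + x ^ 7 + 2 * x ^ 8 +
    2 * x ^ 9 + x ^ 11) * h13 + 3 * hphi + h3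

lemma nonzero_square_mod_thirteen (l : ZMod 13) (h0 : l ≠ 0) (hl : IsSquare l) :
    l = 1 ∨ l = 3 ∨ l = 4 ∨ l = 9 ∨ l = 10 ∨ l = 12 := by
  obtain ⟨r, rfl⟩ := hl
  revert r
  decide

/-- The sum of the powers with nonzero square exponents is unchanged when the primitive root is
replaced by its power with a nonzero square exponent. -/
lemma sum_squares_pow {x : K} (h13 : x ^ 13 = 1) (l : ZMod 13) (h0 : l ≠ 0) (hl : IsSquare l) :
    x ^ l.val + (x ^ l.val) ^ 3 + (x ^ l.val) ^ 4 + (x ^ l.val) ^ 9 + (x ^ l.val) ^ 10 +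
      (x ^ l.val) ^ 12 = x + x ^ 3 + x ^ 4 + x ^ 9 + x ^ 10 + x ^ 12 := by
  have hmod (n : ℕ) : x ^ n = x ^ (n % 13) := pow_eq_pow_mod n h13
  have hval : l.val = 1 ∨ l.val = 3 ∨ l.val = 4 ∨ l.val = 9 ∨ l.val = 10 ∨ l.val = 12 := by
    rcases nonzero_square_mod_thirteen l h0 hl with rfl | rfl | rfl | rfl | rfl | rfl <;> decide
  rw [← pow_mul, ← pow_mul, ← pow_mul, ← pow_mul, ← pow_mul, hmod (l.val * 3), hmod (l.val * 4),
    hmod (l.val * 9), hmod (l.val * 10), hmod (l.val * 12)]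
  rcases hval with h | h | h | h | h | h <;> rw [h] <;> norm_num <;> ring

lemma isPrimitiveRoot_pow_val {x : K} (hx : IsPrimitiveRoot x 13) {l : ZMod 13} (h0 : l ≠ 0) :
    IsPrimitiveRoot (x ^ l.val) 13 := by
  refine hx.pow_of_coprime _ ?_
  refine (Nat.coprime_of_lt_prime ?_ (ZMod.val_lt l) (by norm_num)).symm
  rwa [Ne, ZMod.val_eq_zero]

variable [Algebra (ZMod 3) K]

lemma qr3Mem_sub {α : K} {c d : Fin 13 → ZMod 3} (hc : qr3Mem α c) (hd : qr3Mem α d) :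
    qr3Mem α (c - d) := fun l h0 hl => by
  simp [sub_mul, hc l h0 hl, hd l h0 hl]

lemma extQR3Mem_sub {α : K} {c d : Fin 14 → ZMod 3} (hc : extQR3Mem α c)
    (hd : extQR3Mem α d) : extQR3Mem α (c - d) := by
  refine ⟨qr3Mem_sub hc.1 hd.1, ?_⟩
  simp only [Pi.sub_apply, hc.2, hd.2, Finset.sum_sub_distrib]
  ring

/-- A codeword vanishing in the coordinates `6, …, 12` is zero. -/
lemma extQR3Mem_eq_zero {α : K} (hα : IsPrimitiveRoot α 13) {c : Fin 14 → ZMod 3}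
    (hc : extQR3Mem α c) (h : ∀ s : Fin 7, c (Fin.castSucc (Fin.natAdd 6 s)) = 0) : c = 0 := by
  let e : Fin 6 → ZMod 13 := ![1, 3, 4, 9, 10, 12]
  have he : ∀ t, e t ≠ 0 ∧ IsSquare (e t) := by
    have he' : ∀ t, e t ≠ 0 ∧ ∃ r, e t = r * r := by decide
    exact he'
  have hinj : Function.Injective fun t => α ^ (e t).val := fun s t hst =>
    (by decide : Function.Injective e)
      (ZMod.val_injective _ (hα.pow_inj (ZMod.val_lt _) (ZMod.val_lt _) hst))
  have hv := Matrix.eq_zero_of_forall_index_sum_mul_pow_eq_zero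
    (v := fun i : Fin 6 => algebraMap (ZMod 3) K (c (Fin.castSucc (Fin.castAdd 7 i)))) hinj
    fun t => by
      have := hc.1 (e t) (he t).1 (he t).2
      rw [Fin.sum_univ_add (a := 6) (b := 7)] at this
      simp only [h, map_zero, zero_mul, Finset.sum_const_zero, add_zero, pow_mul] at this
      exact this
  have hfst : ∀ i : Fin 13, c i.castSucc = 0 := fun i => by
    refine Fin.addCases (m := 6) (n := 7) (fun i => ?_) h i
    exact (algebraMap (ZMod 3) K).injective (by simpa using congrFun hv i)
  ext1 i
  refine Fin.lastCases ?_ hfst i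
  rw [hc.2, Finset.sum_eq_zero fun i _ => hfst i, neg_zero, Pi.zero_apply]

lemma IsSystematic.extQR3Mem_encode {G : Fin 7 → Fin 14 → ℕ} (hG : IsSystematic G) {α : K}
    (hrow : ∀ l : ZMod 13, l ≠ 0 → IsSquare l → ∀ r,
      ∑ i : Fin 13, (G r i.castSucc : K) * (α ^ l.val) ^ (i : ℕ) = 0) (m : Fin 7 → ZMod 3) :
    extQR3Mem α (encode G m) := by
  refine ⟨fun l h0 hl => ?_, ?_⟩
  · simp only [encode, map_sum, map_mul, map_natCast, Finset.sum_mul, mul_assoc, pow_mul]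
    rw [Finset.sum_comm]
    simp_rw [← Finset.mul_sum, hrow l h0 hl, mul_zero, Finset.sum_const_zero]
  · simp only [encode, hG.last]
    rw [Finset.sum_comm]
    simp_rw [← Finset.mul_sum, mul_neg, Finset.sum_neg_distrib]

lemma IsSystematic.ncard_shell {G : Fin 7 → Fin 14 → ℕ} (hG : IsSystematic G)
    (hcov : coversTriples (shellTen (packRows G)) = true) {α : K} (hα : IsPrimitiveRoot α 13)
    (hrow : ∀ l : ZMod 13, l ≠ 0 → IsSquare l → ∀ r,
      ∑ i : Fin 13, (G r i.castSucc : K) * (α ^ l.val) ^ (i : ℕ) = 0)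
    {T : Finset (Fin 14)} (hT : T.card = 3) :
    {c : Fin 14 → ZMod 3 | extQR3Mem α c ∧ wt c = 10 ∧ T ⊆ supp c}.ncard = 180 := by
  have himage : {c : Fin 14 → ZMod 3 | extQR3Mem α c ∧ wt c = 10 ∧ T ⊆ supp c} =
      encode G '' {m | wt (encode G m) = 10 ∧ T ⊆ supp (encode G m)} := by
    ext c
    constructor
    · rintro ⟨hc, hP⟩
      have henc : encode G (fun s => c (Fin.castSucc (Fin.natAdd 6 s))) = c := by
        refine (sub_eq_zero.mp (extQR3Mem_eq_zero hα
          (extQR3Mem_sub hc (hG.extQR3Mem_encode hrow _)) fun s => ?_)).symm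
        rw [Pi.sub_apply, hG.encode_apply, sub_self]
      exact ⟨_, by simpa only [Set.mem_ofPred_eq, henc] using hP, henc⟩
    · rintro ⟨m, hm, rfl⟩
      exact ⟨hG.extQR3Mem_encode hrow m, hm⟩
  rw [himage, Set.ncard_image_of_injective _ hG.encode_injective,
    ← card_encode_of_coversTriples (by norm_num) G hG.le_two hcov hT, ← Set.ncard_coe_finset]
  simp

end Code

/-- For the extended ternary quadratic residue code `C` of length 14, the shell `C₁₀` is a
combinatorial `3`-`(14, 10, 180)` design with repeated blocks: every 3-element subset of
the coordinates is contained in the support of exactly 180 codewords of weight 10. -/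
theorem ternary_shell_ten_three_design (K : Type) [Field K] [Algebra (ZMod 3) K] (α : K)
    (hα : IsPrimitiveRoot α 13) :
    ∀ T : Finset (Fin 14), T.card = 3 →
      {c : Fin 14 → ZMod 3 | extQR3Mem α c ∧ wt c = 10 ∧ T ⊆ supp c}.ncard = 180 := by
  have h3 : (3 : K) = 0 := by
    rw [← map_ofNat (algebraMap (ZMod 3) K) 3, show (OfNat.ofNat 3 : ZMod 3) = 0 from rfl,
      map_zero]
  intro T hT
  rcases sum_squares_eq_zero_or h3 hα with hs | hs
  · refine isSystematic_genZero.ncard_shell coversTriples_genZero hα (fun l h0 hl => ?_) hT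
    refine row_genZero h3 (root_genZero h3 (isPrimitiveRoot_pow_val hα h0) ?_)
    rw [sum_squares_pow hα.pow_eq_one l h0 hl, hs]
  · refine isSystematic_genNegOne.ncard_shell coversTriples_genNegOne hα (fun l h0 hl => ?_) hT
    refine row_genNegOne h3 (root_genNegOne h3 (isPrimitiveRoot_pow_val hα h0) ?_)
    linear_combination sum_squares_pow hα.pow_eq_one l h0 hl + hs
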